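/- Fix a convex set K ⊆ ℝ and a continuous map I : B₀(Σ,K) → ℝ̄. The following are equivalent: (i) I is monotone and normalized; (ii) there exists a family Φ of monotone and quasiconvex functionals from B₀(Σ,K) to ℝ̄ such that I(φ) = min_{J∈Φ} J(φ) for all φ ∈ B₀(Σ,K) (with the minimum attained) and min_{J∈Φ} J(k·1_S) = k for all k ∈ K; (iii) there exists a family Ψ of monotone and quasiconcave functionals from B₀(Σ,K) to ℝ̄ such that I(φ) = max_{H∈Ψ} H(φ) for all φ ∈ B₀(Σ,K) (with the maximum attained) and max_{H∈Ψ} H(k·1_S) = k for all k ∈ K. -/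

import Mathlib

variable {S : Type*} [MeasurableSpace S]

/-- `B₀(Σ,K)`: the set of Σ-measurable simple (finite-range) functions `φ : S → ℝ`
with values in `K`. -/
def B0 (K : Set ℝ) : Set (S → ℝ) :=
  {φ | Measurable φ ∧ (Set.range φ).Finite ∧ Set.range φ ⊆ K}

/-- An extended-real-valued `I` is monotone on `B₀(Σ,K)`. -/
def EMonotoneOnB0 (K : Set ℝ) (I : (S → ℝ) → EReal) : Prop :=
  ∀ φ : S → ℝ, φ ∈ B0 K → ∀ ψ : S → ℝ, ψ ∈ B0 K → (∀ s, ψ s ≤ φ s) → I ψ ≤ I φ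

/-- An extended-real-valued `I` is normalized on `B₀(Σ,K)`. -/
def ENormalizedOnB0 (K : Set ℝ) (I : (S → ℝ) → EReal) : Prop :=
  ∀ k ∈ K, I (fun _ => k) = (k : EReal)

/-- `I` is quasiconvex on `B₀(Σ,K)`. -/
def EQuasiconvexOnB0 (K : Set ℝ) (I : (S → ℝ) → EReal) : Prop :=
  ∀ α : ℝ, α ∈ Set.Icc (0 : ℝ) 1 → ∀ φ : S → ℝ, φ ∈ B0 K → ∀ ψ : S → ℝ, ψ ∈ B0 K →
    I (fun s => α * φ s + (1 - α) * ψ s) ≤ max (I φ) (I ψ)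

/-- `I` is quasiconcave on `B₀(Σ,K)`. -/
def EQuasiconcaveOnB0 (K : Set ℝ) (I : (S → ℝ) → EReal) : Prop :=
  ∀ α : ℝ, α ∈ Set.Icc (0 : ℝ) 1 → ∀ φ : S → ℝ, φ ∈ B0 K → ∀ ψ : S → ℝ, ψ ∈ B0 K →
    min (I φ) (I ψ) ≤ I (fun s => α * φ s + (1 - α) * ψ s)

/-- `I` is lower semicontinuous on `B₀(Σ,K)` (sup-norm topology). -/
def ELSCOnB0 (K : Set ℝ) (I : (S → ℝ) → EReal) : Prop :=
  ∀ φ : S → ℝ, φ ∈ B0 K → ∀ b : EReal, b < I φ →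
    ∃ δ > (0 : ℝ), ∀ ψ : S → ℝ, ψ ∈ B0 K → (∀ s, |ψ s - φ s| ≤ δ) → b < I ψ

/-- `I` is upper semicontinuous on `B₀(Σ,K)` (sup-norm topology). -/
def EUSCOnB0 (K : Set ℝ) (I : (S → ℝ) → EReal) : Prop :=
  ∀ φ : S → ℝ, φ ∈ B0 K → ∀ b : EReal, I φ < b →
    ∃ δ > (0 : ℝ), ∀ ψ : S → ℝ, ψ ∈ B0 K → (∀ s, |ψ s - φ s| ≤ δ) → I ψ < b

/-- `I` is continuous on `B₀(Σ,K)` (sup-norm topology on the domain, order topology on `ℝ̄`):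
equivalently, it is both lower and upper semicontinuous. -/
def EContinuousOnB0 (K : Set ℝ) (I : (S → ℝ) → EReal) : Prop :=
  ELSCOnB0 K I ∧ EUSCOnB0 K I

open Classical in
/-- The functional equal to `a` at functions below `φ` and to `⊤` elsewhere. -/
noncomputable def lowerStep (φ : S → ℝ) (a : EReal) (ψ : S → ℝ) : EReal :=
  if ψ ≤ φ then a else ⊤

open Classical in
/-- The functional equal to `a` at functions above `φ` and to `⊥` elsewhere. -/
noncomputable def upperStep (φ : S → ℝ) (a : EReal) (ψ : S → ℝ) : EReal :=
  if φ ≤ ψ then a else ⊥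

lemma const_mem_B0 {K : Set ℝ} {k : ℝ} (hk : k ∈ K) : (fun _ : S => k) ∈ B0 K :=
  ⟨measurable_const, Set.finite_range_const, by rintro _ ⟨s, rfl⟩; exact hk⟩

lemma eMonotoneOnB0_lowerStep (K : Set ℝ) (φ : S → ℝ) (a : EReal) :
    EMonotoneOnB0 K (lowerStep φ a) := by
  intro ψ _ χ _ h
  by_cases hψ : ψ ≤ φ
  · have hχ : χ ≤ φ := le_trans h hψ
    simp [lowerStep, hψ, hχ]
  · simp [lowerStep, hψ]

lemma eMonotoneOnB0_upperStep (K : Set ℝ) (φ : S → ℝ) (a : EReal) :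
    EMonotoneOnB0 K (upperStep φ a) := by
  intro ψ _ χ _ h
  by_cases hχ : φ ≤ χ
  · have hψ : φ ≤ ψ := le_trans hχ h
    simp [upperStep, hψ, hχ]
  · simp [upperStep, hχ]

lemma eQuasiconvexOnB0_lowerStep (K : Set ℝ) (φ : S → ℝ) (a : EReal) :
    EQuasiconvexOnB0 K (lowerStep φ a) := by
  intro α hα ψ _ χ _
  by_cases hψ : ψ ≤ φ
  · by_cases hχ : χ ≤ φ
    · have h : (fun s => α * ψ s + (1 - α) * χ s) ≤ φ :=
        convex_Iic (𝕜 := ℝ) φ hψ hχ hα.1 (sub_nonneg.2 hα.2) (by ring)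
      simp [lowerStep, hψ, hχ, h]
    · simp [lowerStep, hχ]
  · simp [lowerStep, hψ]

lemma eQuasiconcaveOnB0_upperStep (K : Set ℝ) (φ : S → ℝ) (a : EReal) :
    EQuasiconcaveOnB0 K (upperStep φ a) := by
  intro α hα ψ _ χ _
  by_cases hψ : φ ≤ ψ
  · by_cases hχ : φ ≤ χ
    · have h : φ ≤ fun s => α * ψ s + (1 - α) * χ s :=
        convex_Ici (𝕜 := ℝ) φ hψ hχ hα.1 (sub_nonneg.2 hα.2) (by ring)
      simp [upperStep, hψ, hχ, h]
    · simp [upperStep, hχ]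
  · simp [upperStep, hψ]

lemma EMonotoneOnB0.le_lowerStep {K : Set ℝ} {I : (S → ℝ) → EReal} (hI : EMonotoneOnB0 K I)
    {φ ψ : S → ℝ} (hφ : φ ∈ B0 K) (hψ : ψ ∈ B0 K) : I ψ ≤ lowerStep φ (I φ) ψ := by
  unfold lowerStep
  split_ifs with h
  · exact hI φ hφ ψ hψ h
  · exact le_top

lemma EMonotoneOnB0.upperStep_le {K : Set ℝ} {I : (S → ℝ) → EReal} (hI : EMonotoneOnB0 K I)
    {φ ψ : S → ℝ} (hφ : φ ∈ B0 K) (hψ : ψ ∈ B0 K) : upperStep φ (I φ) ψ ≤ I ψ := by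
  unfold upperStep
  split_ifs with h
  · exact hI ψ hψ φ hφ h
  · exact bot_le

/-- for a convex `K ⊆ ℝ` and a continuous `I : B₀(Σ,K) → ℝ̄`, the following
are equivalent: (i) `I` is monotone and normalized; (ii) `I` is the pointwise minimum of a
family of monotone quasiconvex functionals, attaining `k` at constants; (iii) `I` is the
pointwise maximum of a family of monotone quasiconcave functionals, attaining `k` at
constants. -/
theorem stmt_13 (K : Set ℝ) (hK : Convex ℝ K) (I : (S → ℝ) → EReal)
    (hcont : EContinuousOnB0 K I) :
    ((EMonotoneOnB0 K I ∧ ENormalizedOnB0 K I) ↔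
      (∃ Φ : Set ((S → ℝ) → EReal),
        (∀ J ∈ Φ, EMonotoneOnB0 K J ∧ EQuasiconvexOnB0 K J) ∧
        (∀ φ : S → ℝ, φ ∈ B0 K → (∀ J ∈ Φ, I φ ≤ J φ) ∧ ∃ J ∈ Φ, J φ = I φ) ∧
        (∀ k ∈ K, (∀ J ∈ Φ, (k : EReal) ≤ J (fun _ => k)) ∧
          ∃ J ∈ Φ, J (fun _ => k) = (k : EReal)))) ∧
    ((EMonotoneOnB0 K I ∧ ENormalizedOnB0 K I) ↔
      (∃ Ψ : Set ((S → ℝ) → EReal),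
        (∀ H ∈ Ψ, EMonotoneOnB0 K H ∧ EQuasiconcaveOnB0 K H) ∧
        (∀ φ : S → ℝ, φ ∈ B0 K → (∀ H ∈ Ψ, H φ ≤ I φ) ∧ ∃ H ∈ Ψ, H φ = I φ) ∧
        (∀ k ∈ K, (∀ H ∈ Ψ, H (fun _ => k) ≤ (k : EReal)) ∧
          ∃ H ∈ Ψ, H (fun _ => k) = (k : EReal)))) := by
  constructor
  · constructor
    · rintro ⟨hmono, hnorm⟩
      have hmin : ∀ φ : S → ℝ, φ ∈ B0 K →
          (∀ J ∈ (fun χ => lowerStep χ (I χ)) '' B0 K, I φ ≤ J φ) ∧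
            ∃ J ∈ (fun χ => lowerStep χ (I χ)) '' B0 K, J φ = I φ := by
        refine fun φ hφ => ⟨?_, _, ⟨φ, hφ, rfl⟩, by simp [lowerStep]⟩
        rintro _ ⟨χ, hχ, rfl⟩
        exact hmono.le_lowerStep hχ hφ
      refine ⟨_, ?_, hmin, fun k hk => ?_⟩
      · rintro _ ⟨χ, -, rfl⟩
        exact ⟨eMonotoneOnB0_lowerStep K χ _, eQuasiconvexOnB0_lowerStep K χ _⟩
      · simpa only [hnorm k hk] using hmin _ (const_mem_B0 hk)
    · rintro ⟨Φ, hΦ, hmin, hconst⟩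
      refine ⟨fun φ hφ ψ hψ h => ?_, fun k hk => ?_⟩
      · obtain ⟨J, hJ, hJφ⟩ := (hmin φ hφ).2
        exact ((hmin ψ hψ).1 J hJ).trans (((hΦ J hJ).1 φ hφ ψ hψ h).trans_eq hJφ)
      · obtain ⟨hle, J, hJ, hJk⟩ := hconst k hk
        obtain ⟨hle', J', hJ', hJk'⟩ := hmin _ (const_mem_B0 hk)
        exact ((hle' J hJ).trans_eq hJk).antisymm ((hle J' hJ').trans_eq hJk')
  · constructor
    · rintro ⟨hmono, hnorm⟩
      have hmax : ∀ φ : S → ℝ, φ ∈ B0 K →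
          (∀ H ∈ (fun χ => upperStep χ (I χ)) '' B0 K, H φ ≤ I φ) ∧
            ∃ H ∈ (fun χ => upperStep χ (I χ)) '' B0 K, H φ = I φ := by
        refine fun φ hφ => ⟨?_, _, ⟨φ, hφ, rfl⟩, by simp [upperStep]⟩
        rintro _ ⟨χ, hχ, rfl⟩
        exact hmono.upperStep_le hχ hφ
      refine ⟨_, ?_, hmax, fun k hk => ?_⟩
      · rintro _ ⟨χ, -, rfl⟩
        exact ⟨eMonotoneOnB0_upperStep K χ _, eQuasiconcaveOnB0_upperStep K χ _⟩
      · simpa only [hnorm k hk] using hmax _ (const_mem_B0 hk)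
    · rintro ⟨Ψ, hΨ, hmax, hconst⟩
      refine ⟨fun φ hφ ψ hψ h => ?_, fun k hk => ?_⟩
      · obtain ⟨H, hH, hHψ⟩ := (hmax ψ hψ).2
        exact hHψ.ge.trans (((hΨ H hH).1 φ hφ ψ hψ h).trans ((hmax φ hφ).1 H hH))
      · obtain ⟨hle, H, hH, hHk⟩ := hconst k hk
        obtain ⟨hle', H', hH', hHk'⟩ := hmax _ (const_mem_B0 hk)
        exact (hHk'.ge.trans (hle H' hH')).antisymm (hHk.ge.trans (hle' H hH))
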